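/- Let V be a smooth periodic mean-zero horizontal vector field on Ω, W(x,y,z) = -∫_0^z ∇_H·V dz', and v a smooth periodic horizontal field. Then |∫_Ω W (V·∂_z v) dxdydz| ≤ C ‖∇V‖₂^{3/2} ‖V‖₂^{1/2} ‖∇v‖₂^{1/2} ‖Δv‖₂^{1/2}, with C depending only on L₁, L₂. -/

import Mathlib

open MeasureTheory Real Set

noncomputable section

abbrev Pt := ℝ × ℝ × ℝ

/-- partial derivative in `x`. -/
def pdx (f : Pt → ℝ) (p : Pt) : ℝ := deriv (fun t => f (t, p.2.1, p.2.2)) p.1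
/-- partial derivative in `y`. -/
def pdy (f : Pt → ℝ) (p : Pt) : ℝ := deriv (fun t => f (p.1, t, p.2.2)) p.2.1
/-- partial derivative in `z`. -/
def pdz (f : Pt → ℝ) (p : Pt) : ℝ := deriv (fun t => f (p.1, p.2.1, t)) p.2.2

/-- full Laplacian. -/
def lap (f : Pt → ℝ) : Pt → ℝ := fun p => pdx (pdx f) p + pdy (pdy f) p + pdz (pdz f) p
/-- horizontal Laplacian. -/
def lapH (f : Pt → ℝ) : Pt → ℝ := fun p => pdx (pdx f) p + pdy (pdy f) p

/-- squared full gradient. -/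
def gradSq (f : Pt → ℝ) (p : Pt) : ℝ := (pdx f p)^2 + (pdy f p)^2 + (pdz f p)^2
/-- squared horizontal gradient. -/
def gradHSq (f : Pt → ℝ) (p : Pt) : ℝ := (pdx f p)^2 + (pdy f p)^2

/-- the horizontal domain `M = (0,L₁) × (0,L₂)`. -/
def MSet (L1 L2 : ℝ) : Set (ℝ × ℝ) := Ioo 0 L1 ×ˢ Ioo 0 L2
/-- the domain `Ω = M × (-1,1)`. -/
def OmegaSet (L1 L2 : ℝ) : Set Pt := Ioo 0 L1 ×ˢ (Ioo 0 L2 ×ˢ Ioo (-1 : ℝ) 1)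

/-- integral over `Ω`. -/
def intOn (L1 L2 : ℝ) (G : Pt → ℝ) : ℝ := ∫ p in OmegaSet L1 L2, G p

/-- periodicity in `x`, `y`, `z` with periods `L₁`, `L₂`, `2`. -/
def Periodic3 (L1 L2 : ℝ) (f : Pt → ℝ) : Prop :=
  (∀ p : Pt, f (p.1 + L1, p.2.1, p.2.2) = f p) ∧
  (∀ p : Pt, f (p.1, p.2.1 + L2, p.2.2) = f p) ∧
  (∀ p : Pt, f (p.1, p.2.1, p.2.2 + 2) = f p)

/-- squared `L²(Ω)` norm. -/
def L2sq (L1 L2 : ℝ) (F : Pt → ℝ) : ℝ := intOn L1 L2 (fun p => (F p)^2)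
/-- `L²(Ω)` norm. -/
def L2n (L1 L2 : ℝ) (F : Pt → ℝ) : ℝ := Real.sqrt (L2sq L1 L2 F)
/-- `L²(Ω)` norm of the horizontal gradient. -/
def L2gradH (L1 L2 : ℝ) (F : Pt → ℝ) : ℝ := Real.sqrt (intOn L1 L2 (gradHSq F))
/-- `L²(Ω)` norm of the full gradient. -/
def L2grad (L1 L2 : ℝ) (F : Pt → ℝ) : ℝ := Real.sqrt (intOn L1 L2 (gradSq F))

/-- first component of a horizontal vector field. -/
def c1 (v : Pt → ℝ × ℝ) : Pt → ℝ := fun p => (v p).1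
/-- second component of a horizontal vector field. -/
def c2 (v : Pt → ℝ × ℝ) : Pt → ℝ := fun p => (v p).2

/-- horizontal divergence. -/
def divH (v : Pt → ℝ × ℝ) : Pt → ℝ := fun p => pdx (c1 v) p + pdy (c2 v) p

/-- squared `L²(Ω)` norm of a horizontal vector field. -/
def vL2sq (L1 L2 : ℝ) (v : Pt → ℝ × ℝ) : ℝ := L2sq L1 L2 (c1 v) + L2sq L1 L2 (c2 v)
def vL2n (L1 L2 : ℝ) (v : Pt → ℝ × ℝ) : ℝ := Real.sqrt (vL2sq L1 L2 v)
/-- squared `L²(Ω)` norm of the full gradient of a horizontal vector field. -/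
def vGradSq (L1 L2 : ℝ) (v : Pt → ℝ × ℝ) : ℝ :=
  intOn L1 L2 (fun p => gradSq (c1 v) p + gradSq (c2 v) p)
def vGradn (L1 L2 : ℝ) (v : Pt → ℝ × ℝ) : ℝ := Real.sqrt (vGradSq L1 L2 v)
/-- squared `L²(Ω)` norm of the Laplacian of a horizontal vector field. -/
def vLapSq (L1 L2 : ℝ) (v : Pt → ℝ × ℝ) : ℝ :=
  intOn L1 L2 (fun p => (lap (c1 v) p)^2 + (lap (c2 v) p)^2)
def vLapn (L1 L2 : ℝ) (v : Pt → ℝ × ℝ) : ℝ := Real.sqrt (vLapSq L1 L2 v)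
/-- periodicity of a horizontal vector field. -/
def vPeriodic (L1 L2 : ℝ) (v : Pt → ℝ × ℝ) : Prop :=
  Periodic3 L1 L2 (c1 v) ∧ Periodic3 L1 L2 (c2 v)

section Interval

theorem intervalIntegral_abs_le_of_mem {f : ℝ → ℝ} (hf : Continuous f) {a b c d : ℝ} (hab : a ≤ b)
    (hc : c ∈ Icc a b) (hd : d ∈ Icc a b) :
    |∫ t in c..d, f t| ≤ ∫ t in a..b, |f t| := by
  have hsub : uIoc c d ⊆ uIoc a b := by
    intro t ht
    rw [uIoc_of_le hab]
    rcases le_total c d with h | h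
    · rw [uIoc_of_le h] at ht
      exact ⟨hc.1.trans_lt ht.1, ht.2.trans hd.2⟩
    · rw [uIoc_of_ge h] at ht
      exact ⟨hd.1.trans_lt ht.1, ht.2.trans hc.2⟩
  calc |∫ t in c..d, f t| ≤ |∫ t in c..d, (|f t|)| := by
        simpa using intervalIntegral.norm_integral_le_abs_integral_norm (f := f) (a := c) (b := d)
          (μ := volume)
    _ ≤ |∫ t in a..b, (|f t|)| :=
        intervalIntegral.abs_integral_mono_interval hsub
          (Filter.Eventually.of_forall fun t => abs_nonneg (f t)) (hf.abs.intervalIntegrable a b)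
    _ = ∫ t in a..b, (|f t|) :=
        abs_of_nonneg (intervalIntegral.integral_nonneg hab fun t _ => abs_nonneg (f t))

theorem intervalIntegral_mono_of_continuous {f g : ℝ → ℝ} (hf : Continuous f) (hg : Continuous g)
    {a b : ℝ} (hab : a ≤ b) (h : ∀ t ∈ Icc a b, f t ≤ g t) :
    ∫ t in a..b, f t ≤ ∫ t in a..b, g t :=
  intervalIntegral.integral_mono_on hab (hf.intervalIntegrable a b) (hg.intervalIntegrable a b) h

theorem intervalIntegral_sq_nonneg (f : ℝ → ℝ) {a b : ℝ} (hab : a ≤ b) :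
    0 ≤ ∫ t in a..b, f t ^ 2 :=
  intervalIntegral.integral_nonneg hab fun t _ => sq_nonneg (f t)

/-- Cauchy-Schwarz inequality for continuous functions on an interval. -/
theorem sq_intervalIntegral_mul_le {f g : ℝ → ℝ} (hf : Continuous f) (hg : Continuous g)
    {a b : ℝ} (hab : a ≤ b) :
    (∫ t in a..b, f t * g t) ^ 2 ≤ (∫ t in a..b, f t ^ 2) * ∫ t in a..b, g t ^ 2 := by
  have key : ∀ s : ℝ, 0 ≤ (∫ t in a..b, g t ^ 2) * (s * s) +
      (2 * ∫ t in a..b, f t * g t) * s + ∫ t in a..b, f t ^ 2 := by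
    intro s
    have h := intervalIntegral_sq_nonneg (fun t => s * g t + f t) hab
    have e : ∫ t in a..b, (s * g t + f t) ^ 2 = (∫ t in a..b, g t ^ 2) * (s * s) +
      (2 * ∫ t in a..b, f t * g t) * s + ∫ t in a..b, f t ^ 2 := by
      rw [← intervalIntegral.integral_mul_const, ← intervalIntegral.integral_const_mul,
        ← intervalIntegral.integral_mul_const, ← intervalIntegral.integral_add,
        ← intervalIntegral.integral_add]
      · congr 1; ext t; ring
      all_goals exact Continuous.intervalIntegrable (by fun_prop) _ _
    linarith
  have := discrim_le_zero key
  unfold discrim at this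
  nlinarith

theorem intervalIntegral_mul_le_sqrt {f g : ℝ → ℝ} (hf : Continuous f) (hg : Continuous g)
    {a b : ℝ} (hab : a ≤ b) :
    ∫ t in a..b, f t * g t ≤ √(∫ t in a..b, f t ^ 2) * √(∫ t in a..b, g t ^ 2) := by
  rw [← Real.sqrt_mul (intervalIntegral_sq_nonneg f hab)]
  exact Real.le_sqrt_of_sq_le (sq_intervalIntegral_mul_le hf hg hab)

theorem sq_intervalIntegral_le {f : ℝ → ℝ} (hf : Continuous f) {a b : ℝ} (hab : a ≤ b) :
    (∫ t in a..b, f t) ^ 2 ≤ (b - a) * ∫ t in a..b, f t ^ 2 := by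
  have := sq_intervalIntegral_mul_le (f := fun _ => 1) continuous_const hf hab
  simpa using this

theorem exists_mul_eq_intervalIntegral {f : ℝ → ℝ} (hf : Continuous f) {a b : ℝ} (hab : a < b) :
    ∃ c ∈ Icc a b, (b - a) * f c = ∫ t in a..b, f t := by
  obtain ⟨c, hc, h⟩ := exists_eq_interval_average hab.ne hf.continuousOn
  refine ⟨c, ?_, ?_⟩
  · rw [uIoo_of_le hab.le] at hc
    exact Ioo_subset_Icc_self hc
  · rw [h, interval_average_eq_div]
    field_simp [(sub_pos.2 hab).ne']

/-- Poincaré inequality on an interval, for a function of bounded oscillation. -/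
theorem intervalIntegral_sq_le_of_abs_sub_le {f : ℝ → ℝ} (hf : Continuous f) {a b M : ℝ}
    (hab : a < b) (hM : ∀ x ∈ Icc a b, ∀ y ∈ Icc a b, |f x - f y| ≤ M) :
    ∫ t in a..b, f t ^ 2 ≤ (b - a) * M ^ 2 + (∫ t in a..b, f t) ^ 2 / (b - a) := by
  obtain ⟨c, hc, h⟩ := exists_mul_eq_intervalIntegral hf hab
  have hb : 0 < b - a := sub_pos.2 hab
  have h1 : ∫ t in a..b, (f t - f c) ^ 2 ≤ ∫ t in a..b, M ^ 2 := by
    refine intervalIntegral_mono_of_continuous (by fun_prop) (by fun_prop) hab.le fun t ht => ?_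
    exact sq_le_sq' (abs_le.1 (hM t ht c hc)).1 (abs_le.1 (hM t ht c hc)).2
  have h2 : ∫ t in a..b, (f t - f c) ^ 2 =
      (∫ t in a..b, f t ^ 2) - 2 * f c * (∫ t in a..b, f t) + (b - a) * f c ^ 2 := by
    have : (b - a) * f c ^ 2 = ∫ t in a..b, f c ^ 2 := by simp
    rw [this, ← intervalIntegral.integral_const_mul, ← intervalIntegral.integral_sub,
        ← intervalIntegral.integral_add]
    · congr 1; ext t; ring
    all_goals exact Continuous.intervalIntegrable (by fun_prop) _ _
  rw [h2, ← h] at h1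
  simp only [intervalIntegral.integral_const, smul_eq_mul] at h1
  rw [← h]
  have : ((b - a) * f c) ^ 2 / (b - a) = (b - a) * f c ^ 2 := by field_simp
  rw [this]
  linarith

theorem sub_le_intervalIntegral_abs {f f' : ℝ → ℝ} (hf : ∀ t, HasDerivAt f (f' t) t)
    (hf' : Continuous f') {a b : ℝ} (hab : a ≤ b) {x y : ℝ} (hx : x ∈ Icc a b) (hy : y ∈ Icc a b) :
    |f x - f y| ≤ ∫ t in a..b, |f' t| := by
  rw [← intervalIntegral.integral_eq_sub_of_hasDerivAt (fun t _ => hf t)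
    (hf'.intervalIntegrable y x)]
  exact intervalIntegral_abs_le_of_mem hf' hab hy hx

theorem sq_le_intervalIntegral {f f' : ℝ → ℝ} (hf : ∀ t, HasDerivAt f (f' t) t)
    (hf' : Continuous f') {a b : ℝ} (hab : a < b) {x : ℝ} (hx : x ∈ Icc a b) :
    f x ^ 2 ≤ ∫ t in a..b, (f t ^ 2 / (b - a) + 2 * |f t * f' t|) := by
  have hc : Continuous f := continuous_iff_continuousAt.2 fun t => (hf t).continuousAt
  have hb : 0 < b - a := sub_pos.2 hab
  obtain ⟨c, hcm, h⟩ := exists_mul_eq_intervalIntegral (f := fun t => f t ^ 2) (by fun_prop) hab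
  have h1 := sub_le_intervalIntegral_abs (f := fun t => f t ^ 2) (f' := fun t => 2 * (f t * f' t))
    (fun t => by simpa [mul_assoc] using (hf t).fun_pow 2) (by fun_prop) hab.le hx hcm
  have h2 : ∫ t in a..b, (f t ^ 2 / (b - a) + 2 * |f t * f' t|) =
      (∫ t in a..b, f t ^ 2) / (b - a) + ∫ t in a..b, |2 * (f t * f' t)| := by
    rw [← intervalIntegral.integral_div, ← intervalIntegral.integral_add]
    · simp [abs_mul]
    all_goals exact Continuous.intervalIntegrable (by fun_prop) _ _
  rw [h2, ← h, mul_div_cancel_left₀ _ hb.ne']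
  linarith [le_abs_self (f x ^ 2 - f c ^ 2)]

end Interval

section IteratedIntegral

variable {L1 L2 : ℝ} {G : Pt → ℝ}

theorem integrableOn_OmegaSet (hG : Continuous G) : IntegrableOn G (OmegaSet L1 L2) := by
  refine (hG.continuousOn.integrableOn_compact
    (isCompact_Icc.prod (isCompact_Icc.prod isCompact_Icc)) :
      IntegrableOn G (Icc 0 L1 ×ˢ (Icc 0 L2 ×ˢ Icc (-1 : ℝ) 1))).mono_set ?_
  exact prod_mono Ioo_subset_Icc_self (prod_mono Ioo_subset_Icc_self Ioo_subset_Icc_self)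

theorem intOn_eq_xyz (h1 : 0 ≤ L1) (h2 : 0 ≤ L2) (hG : Continuous G) :
    intOn L1 L2 G = ∫ x in (0 : ℝ)..L1, ∫ y in (0 : ℝ)..L2, ∫ z in (-1 : ℝ)..1, G (x, y, z) := by
  have hi : IntegrableOn G (OmegaSet L1 L2) := integrableOn_OmegaSet hG
  unfold intOn OmegaSet
  unfold OmegaSet at hi
  rw [Measure.volume_eq_prod] at hi ⊢
  rw [setIntegral_prod _ hi, intervalIntegral.integral_of_le h1, integral_Ioc_eq_integral_Ioo]
  congr 1
  ext x
  have hx : Continuous fun q : ℝ × ℝ => G (x, q) := by fun_prop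
  have hi' : IntegrableOn (fun q : ℝ × ℝ => G (x, q)) (Ioo 0 L2 ×ˢ Ioo (-1 : ℝ) 1) :=
    (hx.continuousOn.integrableOn_compact (isCompact_Icc.prod isCompact_Icc) :
      IntegrableOn _ (Icc 0 L2 ×ˢ Icc (-1 : ℝ) 1)).mono_set
        (prod_mono Ioo_subset_Icc_self Ioo_subset_Icc_self)
  rw [Measure.volume_eq_prod] at hi' ⊢
  rw [setIntegral_prod _ hi', intervalIntegral.integral_of_le h2, integral_Ioc_eq_integral_Ioo]
  congr 1
  ext y
  rw [intervalIntegral.integral_of_le (by norm_num), integral_Ioc_eq_integral_Ioo]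

theorem intervalIntegral_swap_of_continuous {f : ℝ → ℝ → ℝ}
    (hf : Continuous fun q : ℝ × ℝ => f q.1 q.2) (a b c d : ℝ) :
    ∫ x in a..b, ∫ y in c..d, f x y = ∫ y in c..d, ∫ x in a..b, f x y := by
  refine intervalIntegral_intervalIntegral_swap ?_
  exact (hf.continuousOn.integrableOn_compact (isCompact_uIcc.prod isCompact_uIcc) :
    IntegrableOn _ (uIcc a b ×ˢ uIcc c d)).mono_set (prod_mono uIoc_subset_uIcc uIoc_subset_uIcc)

theorem intOn_eq_xzy (h1 : 0 ≤ L1) (h2 : 0 ≤ L2) (hG : Continuous G) :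
    intOn L1 L2 G = ∫ x in (0 : ℝ)..L1, ∫ z in (-1 : ℝ)..1, ∫ y in (0 : ℝ)..L2, G (x, y, z) := by
  rw [intOn_eq_xyz h1 h2 hG]
  congr 1
  ext x
  exact intervalIntegral_swap_of_continuous (by fun_prop) _ _ _ _

theorem intOn_eq_zxy (h1 : 0 ≤ L1) (h2 : 0 ≤ L2) (hG : Continuous G) :
    intOn L1 L2 G = ∫ z in (-1 : ℝ)..1, ∫ x in (0 : ℝ)..L1, ∫ y in (0 : ℝ)..L2, G (x, y, z) := by
  rw [intOn_eq_xzy h1 h2 hG]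
  exact intervalIntegral_swap_of_continuous (by fun_prop) _ _ _ _

theorem intOn_eq_zyx (h1 : 0 ≤ L1) (h2 : 0 ≤ L2) (hG : Continuous G) :
    intOn L1 L2 G = ∫ z in (-1 : ℝ)..1, ∫ y in (0 : ℝ)..L2, ∫ x in (0 : ℝ)..L1, G (x, y, z) := by
  rw [intOn_eq_zxy h1 h2 hG]
  congr 1
  ext z
  exact intervalIntegral_swap_of_continuous (by fun_prop) _ _ _ _

theorem intOn_eq_yzx (h1 : 0 ≤ L1) (h2 : 0 ≤ L2) (hG : Continuous G) :
    intOn L1 L2 G = ∫ y in (0 : ℝ)..L2, ∫ z in (-1 : ℝ)..1, ∫ x in (0 : ℝ)..L1, G (x, y, z) := by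
  rw [intOn_eq_zyx h1 h2 hG]
  exact intervalIntegral_swap_of_continuous (by fun_prop) _ _ _ _

theorem intOn_add {F : Pt → ℝ} (hF : Continuous F) (hG : Continuous G) :
    intOn L1 L2 (fun p => F p + G p) = intOn L1 L2 F + intOn L1 L2 G :=
  integral_add (integrableOn_OmegaSet hF) (integrableOn_OmegaSet hG)

theorem intOn_sub {F : Pt → ℝ} (hF : Continuous F) (hG : Continuous G) :
    intOn L1 L2 (fun p => F p - G p) = intOn L1 L2 F - intOn L1 L2 G :=
  integral_sub (integrableOn_OmegaSet hF) (integrableOn_OmegaSet hG)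

theorem intOn_const_mul (c : ℝ) : intOn L1 L2 (fun p => c * G p) = c * intOn L1 L2 G :=
  integral_const_mul c G

theorem intOn_mono {F : Pt → ℝ} (hF : Continuous F) (hG : Continuous G) (h : ∀ p, F p ≤ G p) :
    intOn L1 L2 F ≤ intOn L1 L2 G :=
  integral_mono (integrableOn_OmegaSet hF) (integrableOn_OmegaSet hG) h

theorem intOn_nonneg (h : ∀ p, 0 ≤ G p) : 0 ≤ intOn L1 L2 G :=
  integral_nonneg h

/-- Cauchy-Schwarz inequality on `Ω`. -/
theorem sq_intOn_mul_le {F : Pt → ℝ} (hF : Continuous F) (hG : Continuous G) :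
    intOn L1 L2 (fun p => F p * G p) ^ 2 ≤
      intOn L1 L2 (fun p => F p ^ 2) * intOn L1 L2 (fun p => G p ^ 2) := by
  have key : ∀ s : ℝ, 0 ≤ intOn L1 L2 (fun p => G p ^ 2) * (s * s) +
      (2 * intOn L1 L2 (fun p => F p * G p)) * s + intOn L1 L2 (fun p => F p ^ 2) := by
    intro s
    have h : 0 ≤ intOn L1 L2 (fun p => (s * G p + F p) ^ 2) := intOn_nonneg fun p => sq_nonneg _
    have e : (fun p => (s * G p + F p) ^ 2) =
        fun p => (s * s) * G p ^ 2 + ((2 * s) * (F p * G p) + F p ^ 2) := by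
      ext p; ring
    rw [e, intOn_add (by fun_prop) (by fun_prop), intOn_add (by fun_prop) (by fun_prop),
      intOn_const_mul, intOn_const_mul] at h
    linarith
  have := discrim_le_zero key
  unfold discrim at this
  nlinarith

theorem intOn_abs_mul_le {F : Pt → ℝ} (hF : Continuous F) (hG : Continuous G) :
    intOn L1 L2 (fun p => |F p * G p|) ≤ L2n L1 L2 F * L2n L1 L2 G := by
  unfold L2n L2sq
  rw [← Real.sqrt_mul (intOn_nonneg fun p => sq_nonneg _)]
  refine Real.le_sqrt_of_sq_le ?_
  simpa [abs_mul] using sq_intOn_mul_le (L1 := L1) (L2 := L2) hF.abs hG.abs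

end IteratedIntegral

section PartialDerivative

variable {f g : Pt → ℝ}

theorem hasDerivAt_slice_x (hf : Differentiable ℝ f) (x y z : ℝ) :
    HasDerivAt (fun t => f (t, y, z)) (fderiv ℝ f (x, y, z) (1, 0, 0)) x :=
  (hf (x, y, z)).hasFDerivAt.comp_hasDerivAt x
    ((hasDerivAt_id x).prodMk (hasDerivAt_const x (y, z)))

theorem hasDerivAt_slice_y (hf : Differentiable ℝ f) (x y z : ℝ) :
    HasDerivAt (fun t => f (x, t, z)) (fderiv ℝ f (x, y, z) (0, 1, 0)) y :=
  (hf (x, y, z)).hasFDerivAt.comp_hasDerivAt y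
    ((hasDerivAt_const y x).prodMk ((hasDerivAt_id y).prodMk (hasDerivAt_const y z)))

theorem hasDerivAt_slice_z (hf : Differentiable ℝ f) (x y z : ℝ) :
    HasDerivAt (fun t => f (x, y, t)) (fderiv ℝ f (x, y, z) (0, 0, 1)) z :=
  (hf (x, y, z)).hasFDerivAt.comp_hasDerivAt z
    ((hasDerivAt_const z x).prodMk ((hasDerivAt_const z y).prodMk (hasDerivAt_id z)))

theorem pdx_eq_fderiv (hf : Differentiable ℝ f) : pdx f = fun p => fderiv ℝ f p (1, 0, 0) :=
  funext fun p => (hasDerivAt_slice_x hf p.1 p.2.1 p.2.2).deriv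

theorem pdy_eq_fderiv (hf : Differentiable ℝ f) : pdy f = fun p => fderiv ℝ f p (0, 1, 0) :=
  funext fun p => (hasDerivAt_slice_y hf p.1 p.2.1 p.2.2).deriv

theorem pdz_eq_fderiv (hf : Differentiable ℝ f) : pdz f = fun p => fderiv ℝ f p (0, 0, 1) :=
  funext fun p => (hasDerivAt_slice_z hf p.1 p.2.1 p.2.2).deriv

theorem hasDerivAt_pdx (hf : Differentiable ℝ f) (x y z : ℝ) :
    HasDerivAt (fun t => f (t, y, z)) (pdx f (x, y, z)) x :=
  (hasDerivAt_slice_x hf x y z).differentiableAt.hasDerivAt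

theorem hasDerivAt_pdy (hf : Differentiable ℝ f) (x y z : ℝ) :
    HasDerivAt (fun t => f (x, t, z)) (pdy f (x, y, z)) y :=
  (hasDerivAt_slice_y hf x y z).differentiableAt.hasDerivAt

theorem hasDerivAt_pdz (hf : Differentiable ℝ f) (x y z : ℝ) :
    HasDerivAt (fun t => f (x, y, t)) (pdz f (x, y, z)) z :=
  (hasDerivAt_slice_z hf x y z).differentiableAt.hasDerivAt

theorem contDiff_fderiv_apply (hf : ContDiff ℝ (⊤ : ℕ∞) f) (e : Pt) :
    ContDiff ℝ (⊤ : ℕ∞) fun p => fderiv ℝ f p e :=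
  (hf.fderiv_right (m := (⊤ : ℕ∞)) (by simp)).clm_apply contDiff_const

theorem differentiable_of_smooth (hf : ContDiff ℝ (⊤ : ℕ∞) f) : Differentiable ℝ f :=
  hf.differentiable (by simp)

theorem contDiff_pdx (hf : ContDiff ℝ (⊤ : ℕ∞) f) : ContDiff ℝ (⊤ : ℕ∞) (pdx f) := by
  rw [pdx_eq_fderiv (differentiable_of_smooth hf)]
  exact contDiff_fderiv_apply hf _

theorem contDiff_pdy (hf : ContDiff ℝ (⊤ : ℕ∞) f) : ContDiff ℝ (⊤ : ℕ∞) (pdy f) := by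
  rw [pdy_eq_fderiv (differentiable_of_smooth hf)]
  exact contDiff_fderiv_apply hf _

theorem contDiff_pdz (hf : ContDiff ℝ (⊤ : ℕ∞) f) : ContDiff ℝ (⊤ : ℕ∞) (pdz f) := by
  rw [pdz_eq_fderiv (differentiable_of_smooth hf)]
  exact contDiff_fderiv_apply hf _

theorem fderiv_fderiv_apply_comm (hf : ContDiff ℝ (⊤ : ℕ∞) f) (d e p : Pt) :
    fderiv ℝ (fun q => fderiv ℝ f q d) p e = fderiv ℝ (fun q => fderiv ℝ f q e) p d := by
  have h : DifferentiableAt ℝ (fderiv ℝ f) p :=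
    (hf.fderiv_right (m := (⊤ : ℕ∞)) (by simp)).differentiable (by simp) p
  have hs : IsSymmSndFDerivAt ℝ f p := hf.contDiffAt.isSymmSndFDerivAt
    (by
      simp only [minSmoothness_of_isRCLikeNormedField]
      exact WithTop.coe_le_coe.2 (le_top : (2 : ℕ∞) ≤ ⊤))
  rw [fderiv_clm_apply h (differentiableAt_const d), fderiv_clm_apply h (differentiableAt_const e)]
  simpa using hs e d

theorem Periodic3.pdx {L1 L2 : ℝ} (hf : Periodic3 L1 L2 f) : Periodic3 L1 L2 (pdx f) := by
  refine ⟨fun p => ?_, fun p => ?_, fun p => ?_⟩ <;> unfold _root_.pdx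
  · rw [← deriv_comp_add_const]
    congr 1; ext t; exact hf.1 (t, p.2)
  · congr 1; ext t; exact hf.2.1 (t, p.2)
  · congr 1; ext t; exact hf.2.2 (t, p.2)

theorem Periodic3.pdy {L1 L2 : ℝ} (hf : Periodic3 L1 L2 f) : Periodic3 L1 L2 (pdy f) := by
  refine ⟨fun p => ?_, fun p => ?_, fun p => ?_⟩ <;> unfold _root_.pdy
  · congr 1; ext t; exact hf.1 (p.1, t, p.2.2)
  · rw [← deriv_comp_add_const]
    congr 1; ext t; exact hf.2.1 (p.1, t, p.2.2)
  · congr 1; ext t; exact hf.2.2 (p.1, t, p.2.2)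

theorem Periodic3.pdz {L1 L2 : ℝ} (hf : Periodic3 L1 L2 f) : Periodic3 L1 L2 (pdz f) := by
  refine ⟨fun p => ?_, fun p => ?_, fun p => ?_⟩ <;> unfold _root_.pdz
  · congr 1; ext t; exact hf.1 (p.1, p.2.1, t)
  · congr 1; ext t; exact hf.2.1 (p.1, p.2.1, t)
  · rw [← deriv_comp_add_const]
    congr 1; ext t; exact hf.2.2 (p.1, p.2.1, t)

end PartialDerivative

section Hessian

variable {L1 L2 : ℝ} {f : Pt → ℝ}

theorem intOn_pdx_eq_zero (h1 : 0 ≤ L1) (h2 : 0 ≤ L2) (hf : ContDiff ℝ (⊤ : ℕ∞) f)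
    (hp : Periodic3 L1 L2 f) : intOn L1 L2 (pdx f) = 0 := by
  have hc := (contDiff_pdx hf).continuous
  rw [intOn_eq_zyx h1 h2 hc]
  have key : ∀ y z, ∫ x in (0 : ℝ)..L1, pdx f (x, y, z) = 0 := fun y z => by
    rw [intervalIntegral.integral_eq_sub_of_hasDerivAt
      (fun t _ => hasDerivAt_pdx (differentiable_of_smooth hf) t y z)
      (Continuous.intervalIntegrable (by fun_prop) _ _)]
    simpa [sub_eq_zero] using hp.1 (0, y, z)
  simp [key]

theorem intOn_pdy_eq_zero (h1 : 0 ≤ L1) (h2 : 0 ≤ L2) (hf : ContDiff ℝ (⊤ : ℕ∞) f)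
    (hp : Periodic3 L1 L2 f) : intOn L1 L2 (pdy f) = 0 := by
  have hc := (contDiff_pdy hf).continuous
  rw [intOn_eq_zxy h1 h2 hc]
  have key : ∀ x z, ∫ y in (0 : ℝ)..L2, pdy f (x, y, z) = 0 := fun x z => by
    rw [intervalIntegral.integral_eq_sub_of_hasDerivAt
      (fun t _ => hasDerivAt_pdy (differentiable_of_smooth hf) x t z)
      (Continuous.intervalIntegrable (by fun_prop) _ _)]
    simpa [sub_eq_zero] using hp.2.1 (x, 0, z)
  simp [key]

theorem intervalIntegral_pdz_eq_zero (hf : ContDiff ℝ (⊤ : ℕ∞) f) (hp : Periodic3 L1 L2 f)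
    (x y : ℝ) : ∫ z in (-1 : ℝ)..1, pdz f (x, y, z) = 0 := by
  have hc := (contDiff_pdz hf).continuous
  rw [intervalIntegral.integral_eq_sub_of_hasDerivAt
    (fun t _ => hasDerivAt_pdz (differentiable_of_smooth hf) x y t)
    (Continuous.intervalIntegrable (by fun_prop) _ _)]
  have := hp.2.2 (x, y, -1)
  norm_num at this
  simp [this]

theorem intOn_pdz_eq_zero (h1 : 0 ≤ L1) (h2 : 0 ≤ L2) (hf : ContDiff ℝ (⊤ : ℕ∞) f)
    (hp : Periodic3 L1 L2 f) : intOn L1 L2 (pdz f) = 0 := by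
  rw [intOn_eq_xyz h1 h2 (contDiff_pdz hf).continuous]
  simp [intervalIntegral_pdz_eq_zero hf hp]

theorem Periodic3.mul {g : Pt → ℝ} (hf : Periodic3 L1 L2 f) (hg : Periodic3 L1 L2 g) :
    Periodic3 L1 L2 (fun p => f p * g p) :=
  ⟨fun p => congrArg₂ (· * ·) (hf.1 p) (hg.1 p), fun p => congrArg₂ (· * ·) (hf.2.1 p) (hg.2.1 p),
    fun p => congrArg₂ (· * ·) (hf.2.2 p) (hg.2.2 p)⟩

/-- Directions along which every derivative of a smooth periodic function is periodic and has
vanishing integral over `Ω`. -/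
def IsPeriodicDirection (L1 L2 : ℝ) (e : Pt) : Prop :=
  ∀ f : Pt → ℝ, ContDiff ℝ (⊤ : ℕ∞) f → Periodic3 L1 L2 f →
    Periodic3 L1 L2 (fun p => fderiv ℝ f p e) ∧ intOn L1 L2 (fun p => fderiv ℝ f p e) = 0

theorem isPeriodicDirection_x (h1 : 0 ≤ L1) (h2 : 0 ≤ L2) :
    IsPeriodicDirection L1 L2 (1, 0, 0) := fun f hf hp => by
  rw [← pdx_eq_fderiv (differentiable_of_smooth hf)]
  exact ⟨hp.pdx, intOn_pdx_eq_zero h1 h2 hf hp⟩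

theorem isPeriodicDirection_y (h1 : 0 ≤ L1) (h2 : 0 ≤ L2) :
    IsPeriodicDirection L1 L2 (0, 1, 0) := fun f hf hp => by
  rw [← pdy_eq_fderiv (differentiable_of_smooth hf)]
  exact ⟨hp.pdy, intOn_pdy_eq_zero h1 h2 hf hp⟩

theorem isPeriodicDirection_z (h1 : 0 ≤ L1) (h2 : 0 ≤ L2) :
    IsPeriodicDirection L1 L2 (0, 0, 1) := fun f hf hp => by
  rw [← pdz_eq_fderiv (differentiable_of_smooth hf)]
  exact ⟨hp.pdz, intOn_pdz_eq_zero h1 h2 hf hp⟩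

theorem intOn_fderiv_mul {d e : Pt} (hd : IsPeriodicDirection L1 L2 d)
    (he : IsPeriodicDirection L1 L2 e) (hf : ContDiff ℝ (⊤ : ℕ∞) f) (hp : Periodic3 L1 L2 f) :
    intOn L1 L2 (fun p => fderiv ℝ (fun q => fderiv ℝ f q d) p d *
        fderiv ℝ (fun q => fderiv ℝ f q e) p e) =
      intOn L1 L2 (fun p => fderiv ℝ (fun q => fderiv ℝ f q d) p e ^ 2) := by
  have sd := contDiff_fderiv_apply hf d
  have se := contDiff_fderiv_apply hf e
  have sdd := contDiff_fderiv_apply sd d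
  have sde := contDiff_fderiv_apply sd e
  have see := contDiff_fderiv_apply se e
  have pd := (hd f hf hp).1
  have pe := (he f hf hp).1
  have e1 := (hd _ (sd.mul see) (pd.mul (he _ se pe).1)).2
  have e2 := (he _ (sd.mul sde) (pd.mul (he _ sd pd).1)).2
  have hcomm : ∀ p, fderiv ℝ (fun q => fderiv ℝ (fun q => fderiv ℝ f q d) q e) p e =
      fderiv ℝ (fun q => fderiv ℝ (fun q => fderiv ℝ f q e) q e) p d := fun p => by
    rw [fderiv_fderiv_apply_comm se e d p]
    congr 2
    ext q
    rw [fderiv_fderiv_apply_comm hf d e q]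
  have f1 := fun p => congrArg (fun T => T d)
    (fderiv_fun_mul (differentiable_of_smooth sd p) (differentiable_of_smooth see p))
  have f2 := fun p => congrArg (fun T => T e)
    (fderiv_fun_mul (differentiable_of_smooth sd p) (differentiable_of_smooth sde p))
  have c1 := (contDiff_fderiv_apply (sd.mul see) d).continuous
  have c2 := (contDiff_fderiv_apply (sd.mul sde) e).continuous
  have c3 : Continuous fun p => fderiv ℝ (fun q => fderiv ℝ f q d) p d *
      fderiv ℝ (fun q => fderiv ℝ f q e) p e := (sdd.mul see).continuous
  have c4 : Continuous fun p => fderiv ℝ (fun q => fderiv ℝ f q d) p e ^ 2 :=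
    (sde.pow 2).continuous
  rw [← sub_eq_zero, ← intOn_sub c3 c4, ← sub_zero (0 : ℝ)]
  nth_rewrite 1 [← e1]
  rw [← e2, ← intOn_sub c1 c2]
  congr 1
  ext p
  rw [f1, f2]
  simp only [_root_.add_apply, _root_.smul_apply, smul_eq_mul, hcomm]
  ring

theorem intOn_sq_pdz_le (h1 : 0 ≤ L1) (h2 : 0 ≤ L2) (hf : ContDiff ℝ (⊤ : ℕ∞) f)
    (hp : Periodic3 L1 L2 f) :
    intOn L1 L2 (fun p => pdz (pdz f) p ^ 2) ≤ intOn L1 L2 (fun p => lap f p ^ 2) ∧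
    intOn L1 L2 (fun p => pdy (pdz f) p ^ 2) ≤ intOn L1 L2 (fun p => lap f p ^ 2) := by
  have hx := isPeriodicDirection_x h1 h2
  have hy := isPeriodicDirection_y h1 h2
  have hz := isPeriodicDirection_z h1 h2
  have df := differentiable_of_smooth hf
  have hxy := intOn_fderiv_mul hx hy hf hp
  have hxz := intOn_fderiv_mul hx hz hf hp
  have hzy := intOn_fderiv_mul hz hy hf hp
  simp only [← pdx_eq_fderiv df, ← pdy_eq_fderiv df, ← pdz_eq_fderiv df] at hxy hxz hzy
  have dx := differentiable_of_smooth (contDiff_pdx hf)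
  have dy := differentiable_of_smooth (contDiff_pdy hf)
  have dz := differentiable_of_smooth (contDiff_pdz hf)
  have exx : ∀ p, fderiv ℝ (pdx f) p (1, 0, 0) = pdx (pdx f) p := fun p => by
    rw [pdx_eq_fderiv dx]
  have eyy : ∀ p, fderiv ℝ (pdy f) p (0, 1, 0) = pdy (pdy f) p := fun p => by
    rw [pdy_eq_fderiv dy]
  have ezz : ∀ p, fderiv ℝ (pdz f) p (0, 0, 1) = pdz (pdz f) p := fun p => by
    rw [pdz_eq_fderiv dz]
  have ezy : ∀ p, fderiv ℝ (pdz f) p (0, 1, 0) = pdy (pdz f) p := fun p => by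
    rw [pdy_eq_fderiv dz]
  simp only [exx, eyy, ezz, ezy] at hxy hxz hzy
  have nxy : 0 ≤ intOn L1 L2 (fun p => pdx (pdx f) p * pdy (pdy f) p) :=
    hxy ▸ intOn_nonneg fun p => sq_nonneg _
  have nxz : 0 ≤ intOn L1 L2 (fun p => pdx (pdx f) p * pdz (pdz f) p) :=
    hxz ▸ intOn_nonneg fun p => sq_nonneg _
  have nx : 0 ≤ intOn L1 L2 (fun p => pdx (pdx f) p ^ 2) := intOn_nonneg fun p => sq_nonneg _
  have ny : 0 ≤ intOn L1 L2 (fun p => pdy (pdy f) p ^ 2) := intOn_nonneg fun p => sq_nonneg _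
  have nz : 0 ≤ intOn L1 L2 (fun p => pdz (pdz f) p ^ 2) := intOn_nonneg fun p => sq_nonneg _
  have nzy : 0 ≤ intOn L1 L2 (fun p => pdy (pdz f) p ^ 2) := intOn_nonneg fun p => sq_nonneg _
  have cx := (contDiff_pdx (contDiff_pdx hf)).continuous
  have cy := (contDiff_pdy (contDiff_pdy hf)).continuous
  have cz := (contDiff_pdz (contDiff_pdz hf)).continuous
  have e : (fun p => lap f p ^ 2) = fun p => pdx (pdx f) p ^ 2 + (pdy (pdy f) p ^ 2 +
      (pdz (pdz f) p ^ 2 + (2 * (pdx (pdx f) p * pdy (pdy f) p) +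
      (2 * (pdx (pdx f) p * pdz (pdz f) p) + 2 * (pdz (pdz f) p * pdy (pdy f) p))))) := by
    ext p; unfold lap; ring
  have key : intOn L1 L2 (fun p => lap f p ^ 2) = intOn L1 L2 (fun p => pdx (pdx f) p ^ 2) +
      (intOn L1 L2 (fun p => pdy (pdy f) p ^ 2) + (intOn L1 L2 (fun p => pdz (pdz f) p ^ 2) +
      (2 * intOn L1 L2 (fun p => pdx (pdx f) p * pdy (pdy f) p) +
      (2 * intOn L1 L2 (fun p => pdx (pdx f) p * pdz (pdz f) p) +
      2 * intOn L1 L2 (fun p => pdz (pdz f) p * pdy (pdy f) p))))) := by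
    rw [e]
    iterate 5 rw [intOn_add (by fun_prop) (by fun_prop)]
    simp only [intOn_const_mul]
  rw [hzy] at key
  constructor <;> linarith

end Hessian

section Poincare

theorem intervalIntegral_linear_comb {f g : ℝ → ℝ} (hf : Continuous f) (hg : Continuous g)
    (a b c d : ℝ) :
    ∫ t in a..b, (c * f t + d * g t) = c * (∫ t in a..b, f t) + d * ∫ t in a..b, g t := by
  rw [intervalIntegral.integral_add, intervalIntegral.integral_const_mul,
    intervalIntegral.integral_const_mul]
  all_goals exact Continuous.intervalIntegrable (by fun_prop) _ _

theorem sq_intervalIntegral_abs_le {f : ℝ → ℝ} (hf : Continuous f) {a b : ℝ} (hab : a ≤ b) :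
    (∫ t in a..b, |f t|) ^ 2 ≤ (b - a) * ∫ t in a..b, f t ^ 2 := by
  simpa using sq_intervalIntegral_le hf.abs hab

theorem sq_intervalIntegral_intervalIntegral_abs_le {f : ℝ → ℝ → ℝ}
    (hf : Continuous fun q : ℝ × ℝ => f q.1 q.2) {a b c d : ℝ} (hab : a ≤ b) (hcd : c ≤ d) :
    (∫ x in a..b, ∫ y in c..d, |f x y|) ^ 2 ≤
      (b - a) * ((d - c) * ∫ x in a..b, ∫ y in c..d, f x y ^ 2) := by
  refine (sq_intervalIntegral_le (by fun_prop) hab).trans ?_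
  refine mul_le_mul_of_nonneg_left ?_ (sub_nonneg.2 hab)
  rw [← intervalIntegral.integral_const_mul]
  exact intervalIntegral_mono_of_continuous (by fun_prop) (by fun_prop) hab
    fun x _ => sq_intervalIntegral_abs_le (by fun_prop) hcd

theorem abs_intervalIntegral_sub_le {f g h : ℝ → ℝ} (hf : Continuous f) (hg : Continuous g)
    (hh : Continuous h) {a b : ℝ} (hab : a ≤ b) (H : ∀ t, |f t - g t| ≤ h t) :
    |(∫ t in a..b, f t) - ∫ t in a..b, g t| ≤ ∫ t in a..b, h t := by
  rw [← intervalIntegral.integral_sub (hf.intervalIntegrable _ _) (hg.intervalIntegrable _ _)]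
  exact (intervalIntegral.abs_integral_le_integral_abs hab).trans
    (intervalIntegral_mono_of_continuous (by fun_prop) hh hab fun t _ => H t)

variable {L1 L2 : ℝ} {f : Pt → ℝ}

/-- Poincaré inequality on `Ω` for functions of vanishing integral. -/
theorem intOn_sq_le_of_intOn_eq_zero (h1 : 0 < L1) (h2 : 0 < L2) (hf : ContDiff ℝ (⊤ : ℕ∞) f)
    (h0 : intOn L1 L2 f = 0) :
    intOn L1 L2 (fun p => f p ^ 2) ≤ L1 ^ 2 * intOn L1 L2 (fun p => pdx f p ^ 2) +
      L2 ^ 2 * intOn L1 L2 (fun p => pdy f p ^ 2) + 4 * intOn L1 L2 (fun p => pdz f p ^ 2) := by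
  have df := differentiable_of_smooth hf
  have cf := hf.continuous
  have cx := (contDiff_pdx hf).continuous
  have cy := (contDiff_pdy hf).continuous
  have cz := (contDiff_pdz hf).continuous
  have hz : (-1 : ℝ) ≤ 1 := by norm_num
  let U : ℝ → ℝ → ℝ := fun y z => ∫ x in (0 : ℝ)..L1, f (x, y, z)
  have cU : Continuous fun q : ℝ × ℝ => U q.1 q.2 := by fun_prop
  let S : ℝ → ℝ := fun z => ∫ y in (0 : ℝ)..L2, U y z
  have cS : Continuous S := by fun_prop
  have hS : ∀ z, S z = ∫ x in (0 : ℝ)..L1, ∫ y in (0 : ℝ)..L2, f (x, y, z) := fun z =>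
    intervalIntegral_swap_of_continuous (by fun_prop) _ _ _ _
  have A : ∀ y z, ∫ x in (0 : ℝ)..L1, f (x, y, z) ^ 2 ≤
      L1 ^ 2 * (∫ x in (0 : ℝ)..L1, pdx f (x, y, z) ^ 2) + 1 / L1 * U y z ^ 2 := fun y z => by
    have a1 := intervalIntegral_sq_le_of_abs_sub_le (f := fun x => f (x, y, z)) (by fun_prop) h1
      fun s hs t ht => sub_le_intervalIntegral_abs (fun r => hasDerivAt_pdx df r y z)
        (by fun_prop) h1.le hs ht
    have a2 := mul_le_mul_of_nonneg_left
      (sq_intervalIntegral_abs_le (f := fun x => pdx f (x, y, z)) (by fun_prop) h1.le) h1.le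
    simp only [sub_zero] at a1 a2
    calc _ ≤ _ := a1
      _ ≤ L1 * (L1 * ∫ x in (0 : ℝ)..L1, pdx f (x, y, z) ^ 2) + U y z ^ 2 / L1 := by gcongr
      _ = _ := by ring
  have B : ∀ z, ∫ y in (0 : ℝ)..L2, U y z ^ 2 ≤ (L1 * L2 ^ 2) *
      (∫ x in (0 : ℝ)..L1, ∫ y in (0 : ℝ)..L2, pdy f (x, y, z) ^ 2) + 1 / L2 * S z ^ 2 :=
      fun z => by
    have a1 := intervalIntegral_sq_le_of_abs_sub_le (f := fun y => U y z) (by fun_prop) h2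
      fun s hs t ht => abs_intervalIntegral_sub_le (by fun_prop) (by fun_prop)
        (h := fun x => ∫ y in (0 : ℝ)..L2, |pdy f (x, y, z)|) (by fun_prop) h1.le
        fun x => sub_le_intervalIntegral_abs (fun r => hasDerivAt_pdy df x r z)
          (by fun_prop) h2.le hs ht
    have a2 := mul_le_mul_of_nonneg_left (sq_intervalIntegral_intervalIntegral_abs_le
      (f := fun x y => pdy f (x, y, z)) (by fun_prop) h1.le h2.le) h2.le
    simp only [sub_zero] at a1 a2
    calc _ ≤ _ := a1
      _ ≤ L2 * (L1 * (L2 * ∫ x in (0 : ℝ)..L1, ∫ y in (0 : ℝ)..L2, pdy f (x, y, z) ^ 2)) +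
          S z ^ 2 / L2 := by gcongr
      _ = _ := by ring
  have C : ∫ z in (-1 : ℝ)..1, S z ^ 2 ≤ 4 * L1 * L2 * intOn L1 L2 (fun p => pdz f p ^ 2) := by
    have a1 := intervalIntegral_sq_le_of_abs_sub_le (f := S) (by fun_prop)
      (by norm_num : (-1 : ℝ) < 1)
      fun s hs t ht => by
        rw [hS, hS]
        exact abs_intervalIntegral_sub_le (by fun_prop) (by fun_prop)
          (h := fun x => ∫ y in (0 : ℝ)..L2, ∫ z in (-1 : ℝ)..1, |pdz f (x, y, z)|)
          (by fun_prop) h1.le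
          fun x => abs_intervalIntegral_sub_le (by fun_prop) (by fun_prop) (by fun_prop) h2.le
            fun y => sub_le_intervalIntegral_abs (fun r => hasDerivAt_pdz df x y r)
              (by fun_prop) hz hs ht
    have hS0 : ∫ z in (-1 : ℝ)..1, S z = 0 := by rw [← h0, intOn_eq_zyx h1.le h2.le cf]
    have a2 : (∫ x in (0 : ℝ)..L1, ∫ y in (0 : ℝ)..L2, ∫ z in (-1 : ℝ)..1, |pdz f (x, y, z)|) ^ 2 ≤
        L1 * (L2 * (2 * intOn L1 L2 (fun p => pdz f p ^ 2))) := by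
      have b1 := sq_intervalIntegral_intervalIntegral_abs_le
        (f := fun x y => ∫ z in (-1 : ℝ)..1, |pdz f (x, y, z)|) (by fun_prop) h1.le h2.le
      have b2 : ∀ x y, |∫ z in (-1 : ℝ)..1, (|pdz f (x, y, z)|)| =
          ∫ z in (-1 : ℝ)..1, |pdz f (x, y, z)| := fun x y =>
        abs_of_nonneg (intervalIntegral.integral_nonneg hz fun _ _ => abs_nonneg _)
      simp only [sub_zero, b2] at b1
      refine b1.trans ?_
      gcongr
      rw [intOn_eq_xyz h1.le h2.le (by fun_prop), ← intervalIntegral.integral_const_mul]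
      refine intervalIntegral_mono_of_continuous (by fun_prop) (by fun_prop) h1.le fun x _ => ?_
      rw [← intervalIntegral.integral_const_mul]
      refine intervalIntegral_mono_of_continuous (by fun_prop) (by fun_prop) h2.le fun y _ => ?_
      have := sq_intervalIntegral_abs_le (f := fun z => pdz f (x, y, z)) (by fun_prop) hz
      norm_num at this
      exact this
    rw [hS0] at a1
    norm_num at a1
    linarith
  have B' : ∫ z in (-1 : ℝ)..1, ∫ y in (0 : ℝ)..L2, U y z ^ 2 ≤
      (L1 * L2 ^ 2) * intOn L1 L2 (fun p => pdy f p ^ 2) +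
        1 / L2 * ∫ z in (-1 : ℝ)..1, S z ^ 2 := by
    rw [intOn_eq_zxy h1.le h2.le (by fun_prop),
      ← intervalIntegral_linear_comb (by fun_prop) (by fun_prop)]
    exact intervalIntegral_mono_of_continuous (by fun_prop) (by fun_prop) hz fun z _ => B z
  have A' : intOn L1 L2 (fun p => f p ^ 2) ≤ L1 ^ 2 * intOn L1 L2 (fun p => pdx f p ^ 2) +
      1 / L1 * ∫ z in (-1 : ℝ)..1, ∫ y in (0 : ℝ)..L2, U y z ^ 2 := by
    rw [intOn_eq_zyx h1.le h2.le (by fun_prop), intOn_eq_zyx h1.le h2.le (by fun_prop),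
      ← intervalIntegral_linear_comb (by fun_prop) (by fun_prop)]
    refine intervalIntegral_mono_of_continuous (by fun_prop) (by fun_prop) hz fun z _ => ?_
    rw [← intervalIntegral_linear_comb (by fun_prop) (by fun_prop)]
    exact intervalIntegral_mono_of_continuous (by fun_prop) (by fun_prop) h2.le fun y _ => A y z
  refine A'.trans ?_
  calc _ ≤ L1 ^ 2 * intOn L1 L2 (fun p => pdx f p ^ 2) + 1 / L1 *
      ((L1 * L2 ^ 2) * intOn L1 L2 (fun p => pdy f p ^ 2) +
        1 / L2 * (4 * L1 * L2 * intOn L1 L2 (fun p => pdz f p ^ 2))) := by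
        gcongr
        exact B'.trans (by gcongr)
    _ = _ := by field_simp; ring

theorem intOn_sq_pdz_le_pdz_pdz (h1 : 0 ≤ L1) (h2 : 0 ≤ L2) (hf : ContDiff ℝ (⊤ : ℕ∞) f)
    (hp : Periodic3 L1 L2 f) :
    intOn L1 L2 (fun p => pdz f p ^ 2) ≤ 4 * intOn L1 L2 (fun p => pdz (pdz f) p ^ 2) := by
  have sz := contDiff_pdz hf
  have cz := sz.continuous
  have czz := (contDiff_pdz sz).continuous
  rw [intOn_eq_xyz h1 h2 (by fun_prop), intOn_eq_xyz h1 h2 (by fun_prop),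
    ← intervalIntegral.integral_const_mul]
  refine intervalIntegral_mono_of_continuous (by fun_prop) (by fun_prop) h1 fun x _ => ?_
  rw [← intervalIntegral.integral_const_mul]
  refine intervalIntegral_mono_of_continuous (by fun_prop) (by fun_prop) h2 fun y _ => ?_
  have a1 := intervalIntegral_sq_le_of_abs_sub_le (f := fun z => pdz f (x, y, z)) (by fun_prop)
    (by norm_num : (-1 : ℝ) < 1)
    fun s hs t ht => sub_le_intervalIntegral_abs
      (fun r => hasDerivAt_pdz (differentiable_of_smooth sz) x y r)
      (by fun_prop) (by norm_num) hs ht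
  have a2 := sq_intervalIntegral_abs_le (f := fun z => pdz (pdz f) (x, y, z)) (by fun_prop)
    (by norm_num : (-1 : ℝ) ≤ 1)
  rw [intervalIntegral_pdz_eq_zero hf hp] at a1
  norm_num at a1 a2
  linarith

end Poincare

section Trilinear

variable {L1 L2 : ℝ}

/-- Anisotropic Ladyzhenskaya inequality on `Ω`. -/
theorem intOn_mul_abs_mul_le (h1 : 0 < L1) (h2 : 0 < L2) {F : ℝ → ℝ → ℝ} {g h : Pt → ℝ}
    (hF : Continuous fun q : ℝ × ℝ => F q.1 q.2) (hg : ContDiff ℝ (⊤ : ℕ∞) g)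
    (hh : ContDiff ℝ (⊤ : ℕ∞) h) :
    intOn L1 L2 (fun p => F p.1 p.2.1 * |g p * h p|) ≤
      √(∫ x in (0 : ℝ)..L1, ∫ y in (0 : ℝ)..L2, F x y ^ 2) *
      √(intOn L1 L2 (fun p => g p ^ 2 / L1 + 2 * |g p * pdx g p|) *
        intOn L1 L2 (fun p => h p ^ 2 / L2 + 2 * |h p * pdy h p|)) := by
  have cg := hg.continuous
  have ch := hh.continuous
  have cgx := (contDiff_pdx hg).continuous
  have chy := (contDiff_pdy hh).continuous
  have hz : (-1 : ℝ) ≤ 1 := by norm_num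
  let K : ℝ → ℝ → ℝ := fun x y => ∫ z in (-1 : ℝ)..1, |g (x, y, z) * h (x, y, z)|
  have cK : Continuous fun q : ℝ × ℝ => K q.1 q.2 := by fun_prop
  let a : ℝ → ℝ := fun y => ∫ z in (-1 : ℝ)..1, ∫ x in (0 : ℝ)..L1,
    (g (x, y, z) ^ 2 / L1 + 2 * |g (x, y, z) * pdx g (x, y, z)|)
  let b : ℝ → ℝ := fun x => ∫ z in (-1 : ℝ)..1, ∫ y in (0 : ℝ)..L2,
    (h (x, y, z) ^ 2 / L2 + 2 * |h (x, y, z) * pdy h (x, y, z)|)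
  have ca : Continuous a := by fun_prop
  have cb : Continuous b := by fun_prop
  have hK : ∀ x ∈ Icc 0 L1, ∀ y ∈ Icc 0 L2, K x y ^ 2 ≤ b x * a y := by
    intro x hx y hy
    have k1 := sq_intervalIntegral_mul_le (f := fun z => |g (x, y, z)|)
      (g := fun z => |h (x, y, z)|) (by fun_prop) (by fun_prop) hz
    simp only [← abs_mul, sq_abs] at k1
    have k2 : ∫ z in (-1 : ℝ)..1, g (x, y, z) ^ 2 ≤ a y :=
      intervalIntegral_mono_of_continuous (by fun_prop) (by fun_prop) hz fun z _ => by
        simpa using sq_le_intervalIntegral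
          (fun t => hasDerivAt_pdx (differentiable_of_smooth hg) t y z) (by fun_prop) h1 hx
    have k3 : ∫ z in (-1 : ℝ)..1, h (x, y, z) ^ 2 ≤ b x :=
      intervalIntegral_mono_of_continuous (by fun_prop) (by fun_prop) hz fun z _ => by
        simpa using sq_le_intervalIntegral
          (fun t => hasDerivAt_pdy (differentiable_of_smooth hh) x t z) (by fun_prop) h2 hy
    have k4 := intervalIntegral_sq_nonneg (fun z => g (x, y, z)) hz
    have k5 := intervalIntegral_sq_nonneg (fun z => h (x, y, z)) hz
    calc _ ≤ _ := k1
      _ ≤ a y * b x := mul_le_mul k2 k3 k5 (k4.trans k2)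
      _ = _ := mul_comm _ _
  have hKint : ∫ x in (0 : ℝ)..L1, ∫ y in (0 : ℝ)..L2, K x y ^ 2 ≤
      intOn L1 L2 (fun p => g p ^ 2 / L1 + 2 * |g p * pdx g p|) *
        intOn L1 L2 (fun p => h p ^ 2 / L2 + 2 * |h p * pdy h p|) := by
    rw [intOn_eq_yzx h1.le h2.le (by fun_prop), intOn_eq_xzy h1.le h2.le (by fun_prop), mul_comm,
      ← intervalIntegral.integral_mul_const]
    refine intervalIntegral_mono_of_continuous (by fun_prop) (by fun_prop) h1.le fun x hx => ?_
    rw [← intervalIntegral.integral_const_mul]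
    exact intervalIntegral_mono_of_continuous (by fun_prop) (by fun_prop) h2.le fun y hy =>
      hK x hx y hy
  calc _ = ∫ x in (0 : ℝ)..L1, ∫ y in (0 : ℝ)..L2, F x y * K x y := by
        rw [intOn_eq_xyz h1.le h2.le (by fun_prop)]
        simp only [K, intervalIntegral.integral_const_mul]
    _ ≤ ∫ x in (0 : ℝ)..L1, √(∫ y in (0 : ℝ)..L2, F x y ^ 2) * √(∫ y in (0 : ℝ)..L2, K x y ^ 2) :=
        intervalIntegral_mono_of_continuous (by fun_prop) (by fun_prop) h1.le fun x _ =>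
          intervalIntegral_mul_le_sqrt (by fun_prop) (by fun_prop) h2.le
    _ ≤ √(∫ x in (0 : ℝ)..L1, √(∫ y in (0 : ℝ)..L2, F x y ^ 2) ^ 2) *
        √(∫ x in (0 : ℝ)..L1, √(∫ y in (0 : ℝ)..L2, K x y ^ 2) ^ 2) :=
        intervalIntegral_mul_le_sqrt (by fun_prop) (by fun_prop) h1.le
    _ = √(∫ x in (0 : ℝ)..L1, ∫ y in (0 : ℝ)..L2, F x y ^ 2) *
        √(∫ x in (0 : ℝ)..L1, ∫ y in (0 : ℝ)..L2, K x y ^ 2) := by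
        simp only [Real.sq_sqrt (intervalIntegral_sq_nonneg _ h2.le)]
    _ ≤ _ := by gcongr

theorem L2n_le_of_sq_le {F : Pt → ℝ} {c : ℝ} (hc : 0 ≤ c)
    (h : intOn L1 L2 (fun p => F p ^ 2) ≤ c ^ 2) : L2n L1 L2 F ≤ c :=
  Real.sqrt_le_iff.2 ⟨hc, h⟩

theorem L2n_nonneg (F : Pt → ℝ) : 0 ≤ L2n L1 L2 F := Real.sqrt_nonneg _

theorem intOn_sq_eq_L2n_sq (F : Pt → ℝ) : intOn L1 L2 (fun p => F p ^ 2) = L2n L1 L2 F ^ 2 :=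
  (Real.sq_sqrt (intOn_nonneg fun _ => sq_nonneg _)).symm

theorem intOn_sq_div_add_abs_mul_le {F G : Pt → ℝ} (hF : Continuous F) (hG : Continuous G)
    {l m c d : ℝ} (hl : 0 < l) (hm : L2n L1 L2 F ≤ m) (hc : L2n L1 L2 F ≤ c)
    (hd : L2n L1 L2 G ≤ d) :
    intOn L1 L2 (fun p => F p ^ 2 / l + 2 * |F p * G p|) ≤ m * (c / l + 2 * d) := by
  have e : (fun p => F p ^ 2 / l + 2 * |F p * G p|) =
      fun p => (1 / l) * F p ^ 2 + 2 * |F p * G p| := by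
    ext p; ring
  have hF0 := L2n_nonneg (L1 := L1) (L2 := L2) F
  have hG0 := L2n_nonneg (L1 := L1) (L2 := L2) G
  have hm0 := hF0.trans hm
  rw [e, intOn_add (by fun_prop) (by fun_prop), intOn_const_mul, intOn_const_mul,
    intOn_sq_eq_L2n_sq]
  calc _ ≤ 1 / l * L2n L1 L2 F ^ 2 + 2 * (L2n L1 L2 F * L2n L1 L2 G) := by
        gcongr
        exact intOn_abs_mul_le hF hG
    _ = 1 / l * (L2n L1 L2 F * L2n L1 L2 F) + 2 * (L2n L1 L2 F * L2n L1 L2 G) := by ring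
    _ ≤ 1 / l * (m * c) + 2 * (m * d) := by gcongr
    _ = _ := by ring

theorem intOn_mul_abs_mul_pdz_le (h1 : 0 < L1) (h2 : 0 < L2) {F : ℝ → ℝ → ℝ} {g u : Pt → ℝ}
    (hF : Continuous fun q : ℝ × ℝ => F q.1 q.2) (hg : ContDiff ℝ (⊤ : ℕ∞) g)
    (hu : ContDiff ℝ (⊤ : ℕ∞) u) (hup : Periodic3 L1 L2 u) (hg0 : intOn L1 L2 g = 0)
    {n G D Λ : ℝ} (hG0 : 0 ≤ G) (hΛ0 : 0 ≤ Λ) (hn : L2n L1 L2 g ≤ n)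
    (hG : intOn L1 L2 (gradSq g) ≤ G ^ 2) (hD : L2n L1 L2 (pdz u) ≤ D)
    (hΛ : intOn L1 L2 (fun p => lap u p ^ 2) ≤ Λ ^ 2) :
    intOn L1 L2 (fun p => F p.1 p.2.1 * |g p * pdz u p|) ≤
      √(∫ x in (0 : ℝ)..L1, ∫ y in (0 : ℝ)..L2, F x y ^ 2) *
      √((n * (((L1 + L2 + 2) / L1 + 2) * G)) * (D * ((2 / L2 + 2) * Λ))) := by
  have hgx := (contDiff_pdx hg).continuous
  have hgy := (contDiff_pdy hg).continuous
  have hgz := (contDiff_pdz hg).continuous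
  have huz := contDiff_pdz hu
  have huzy := (contDiff_pdy huz).continuous
  have hz0 : ∀ e : Pt → ℝ, 0 ≤ intOn L1 L2 (fun p => e p ^ 2) := fun e =>
    intOn_nonneg fun p => sq_nonneg _
  have hsplit : intOn L1 L2 (gradSq g) = intOn L1 L2 (fun p => pdx g p ^ 2) +
      intOn L1 L2 (fun p => pdy g p ^ 2) + intOn L1 L2 (fun p => pdz g p ^ 2) := by
    unfold gradSq
    rw [intOn_add (by fun_prop) (by fun_prop), intOn_add (by fun_prop) (by fun_prop)]
  have hx := hz0 (pdx g)
  have hy := hz0 (pdy g)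
  have hz := hz0 (pdz g)
  have a1 : L2n L1 L2 (pdx g) ≤ G := L2n_le_of_sq_le hG0 (by linarith)
  have a2 : L2n L1 L2 g ≤ (L1 + L2 + 2) * G := by
    refine L2n_le_of_sq_le (by positivity) ?_
    calc _ ≤ _ := intOn_sq_le_of_intOn_eq_zero h1 h2 hg hg0
      _ ≤ (L1 + L2 + 2) ^ 2 * intOn L1 L2 (fun p => pdx g p ^ 2) +
          (L1 + L2 + 2) ^ 2 * intOn L1 L2 (fun p => pdy g p ^ 2) +
          (L1 + L2 + 2) ^ 2 * intOn L1 L2 (fun p => pdz g p ^ 2) := by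
          gcongr
          · linarith
          · linarith
          · nlinarith
      _ = (L1 + L2 + 2) ^ 2 * intOn L1 L2 (gradSq g) := by rw [hsplit]; ring
      _ ≤ (L1 + L2 + 2) ^ 2 * G ^ 2 := by gcongr
      _ = _ := by ring
  obtain ⟨hzz, hzy⟩ := intOn_sq_pdz_le h1.le h2.le hu hup
  have b1 : L2n L1 L2 (pdy (pdz u)) ≤ Λ := L2n_le_of_sq_le hΛ0 (hzy.trans hΛ)
  have b2 : L2n L1 L2 (pdz u) ≤ 2 * Λ := by
    refine L2n_le_of_sq_le (by positivity) ?_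
    linarith [intOn_sq_pdz_le_pdz_pdz h1.le h2.le hu hup]
  refine (intOn_mul_abs_mul_le h1 h2 hF hg huz).trans ?_
  have k1 := intOn_sq_div_add_abs_mul_le hg.continuous hgx h1 hn a2 a1
  have k2 := intOn_sq_div_add_abs_mul_le huz.continuous huzy h2 hD b2 b1
  have k3 : 0 ≤ intOn L1 L2 (fun p => pdz u p ^ 2 / L2 + 2 * |pdz u p * pdy (pdz u) p|) :=
    intOn_nonneg fun p => by positivity
  have n0 : 0 ≤ n := (L2n_nonneg g).trans hn
  refine mul_le_mul_of_nonneg_left (Real.sqrt_le_sqrt ?_) (Real.sqrt_nonneg _)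
  refine mul_le_mul (k1.trans_eq (by ring)) (k2.trans_eq (by ring)) k3 (by positivity)

theorem intervalIntegral_sq_divH_le (h1 : 0 ≤ L1) (h2 : 0 ≤ L2) {V : Pt → ℝ × ℝ}
    (hV1 : ContDiff ℝ (⊤ : ℕ∞) (c1 V)) (hV2 : ContDiff ℝ (⊤ : ℕ∞) (c2 V)) :
    ∫ x in (0 : ℝ)..L1, ∫ y in (0 : ℝ)..L2, (∫ z in (-1 : ℝ)..1, |divH V (x, y, z)|) ^ 2 ≤
      4 * vGradSq L1 L2 V := by
  have cx1 := (contDiff_pdx hV1).continuous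
  have cy1 := (contDiff_pdy hV1).continuous
  have cz1 := (contDiff_pdz hV1).continuous
  have cx2 := (contDiff_pdx hV2).continuous
  have cy2 := (contDiff_pdy hV2).continuous
  have cz2 := (contDiff_pdz hV2).continuous
  have cd : Continuous (divH V) := by unfold divH; fun_prop
  have cg : Continuous fun p => gradSq (c1 V) p + gradSq (c2 V) p := by unfold gradSq; fun_prop
  calc _ ≤ 2 * intOn L1 L2 (fun p => divH V p ^ 2) := by
        rw [intOn_eq_xyz h1 h2 (by fun_prop), ← intervalIntegral.integral_const_mul]
        refine intervalIntegral_mono_of_continuous (by fun_prop) (by fun_prop) h1 fun x _ => ?_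
        rw [← intervalIntegral.integral_const_mul]
        refine intervalIntegral_mono_of_continuous (by fun_prop) (by fun_prop) h2 fun y _ => ?_
        have := sq_intervalIntegral_abs_le (f := fun z => divH V (x, y, z)) (by fun_prop)
          (by norm_num : (-1 : ℝ) ≤ 1)
        norm_num at this
        exact this
    _ ≤ 2 * intOn L1 L2 (fun p => 2 * (gradSq (c1 V) p + gradSq (c2 V) p)) := by
        refine mul_le_mul_of_nonneg_left ?_ zero_le_two
        refine intOn_mono (by fun_prop) (by fun_prop) fun p => ?_
        unfold divH gradSq
        nlinarith [sq_nonneg (pdx (c1 V) p - pdy (c2 V) p), sq_nonneg (pdy (c1 V) p),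
          sq_nonneg (pdz (c1 V) p), sq_nonneg (pdx (c2 V) p), sq_nonneg (pdz (c2 V) p)]
    _ = _ := by
        rw [intOn_const_mul, vGradSq]
        ring

end Trilinear

/-- trilinear estimate for the term `∫ W (V·∂_z v)`. -/
theorem stmt_13 (L1 L2 : ℝ) (hL1 : 0 < L1) (hL2 : 0 < L2) :
    ∃ C > 0, ∀ (V v : Pt → ℝ × ℝ) (W : Pt → ℝ),
      ContDiff ℝ (⊤ : ℕ∞) (c1 V) → ContDiff ℝ (⊤ : ℕ∞) (c2 V) →
      ContDiff ℝ (⊤ : ℕ∞) (c1 v) → ContDiff ℝ (⊤ : ℕ∞) (c2 v) →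
      vPeriodic L1 L2 V → vPeriodic L1 L2 v →
      intOn L1 L2 (c1 V) = 0 → intOn L1 L2 (c2 V) = 0 →
      (∀ p : Pt, W p = -∫ z in (0:ℝ)..p.2.2, divH V (p.1, p.2.1, z)) →
      |∫ p in OmegaSet L1 L2,
          W p * ((V p).1 * pdz (c1 v) p + (V p).2 * pdz (c2 v) p)|
        ≤ C * vGradn L1 L2 V * Real.sqrt (vGradn L1 L2 V)
            * Real.sqrt (vL2n L1 L2 V)
            * Real.sqrt (vGradn L1 L2 v) * Real.sqrt (vLapn L1 L2 v) := by
  refine ⟨4 * √(((L1 + L2 + 2) / L1 + 2) * (2 / L2 + 2)), by positivity, ?_⟩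
  intro V v W hV1 hV2 hv1 hv2 _ hvp hV10 hV20 hW
  have hL1' := hL1.le
  have hL2' := hL2.le
  have cd : Continuous (divH V) := by
    have := (contDiff_pdx hV1).continuous
    have := (contDiff_pdy hV2).continuous
    unfold divH
    fun_prop
  have cz1 := (contDiff_pdz hv1).continuous
  have cz2 := (contDiff_pdz hv2).continuous
  have cV1 := hV1.continuous
  have cV2 := hV2.continuous
  let F : ℝ → ℝ → ℝ := fun x y => ∫ z in (-1 : ℝ)..1, |divH V (x, y, z)|
  have cF : Continuous fun q : ℝ × ℝ => F q.1 q.2 := by fun_prop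
  have cFp : Continuous fun p : Pt => F p.1 p.2.1 := by fun_prop
  have hWF : ∀ p ∈ OmegaSet L1 L2, |W p| ≤ F p.1 p.2.1 := fun p hp => by
    rw [hW, abs_neg]
    exact intervalIntegral_abs_le_of_mem (by fun_prop) (by norm_num) (by norm_num)
      (Ioo_subset_Icc_self hp.2.2)
  have hgrad0 : ∀ f : Pt → ℝ, 0 ≤ intOn L1 L2 (gradSq f) := fun f =>
    intOn_nonneg fun p => by unfold gradSq; positivity
  have hcgrad : ∀ f : Pt → ℝ, ContDiff ℝ (⊤ : ℕ∞) f → Continuous (gradSq f) := fun f hf => by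
    have := (contDiff_pdx hf).continuous
    have := (contDiff_pdy hf).continuous
    have := (contDiff_pdz hf).continuous
    unfold gradSq
    fun_prop
  have hclap : ∀ f : Pt → ℝ, ContDiff ℝ (⊤ : ℕ∞) f → Continuous (lap f) := fun f hf => by
    have := (contDiff_pdx (contDiff_pdx hf)).continuous
    have := (contDiff_pdy (contDiff_pdy hf)).continuous
    have := (contDiff_pdz (contDiff_pdz hf)).continuous
    unfold lap
    fun_prop
  have hsq0 : ∀ f : Pt → ℝ, 0 ≤ intOn L1 L2 (fun p => f p ^ 2) := fun f =>
    intOn_nonneg fun p => sq_nonneg _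
  have hgradV : vGradn L1 L2 V ^ 2 = intOn L1 L2 (gradSq (c1 V)) + intOn L1 L2 (gradSq (c2 V)) := by
    rw [← intOn_add (hcgrad _ hV1) (hcgrad _ hV2)]
    exact Real.sq_sqrt (intOn_nonneg fun p => by unfold gradSq; positivity)
  have hgradv : vGradn L1 L2 v ^ 2 = intOn L1 L2 (gradSq (c1 v)) + intOn L1 L2 (gradSq (c2 v)) := by
    rw [← intOn_add (hcgrad _ hv1) (hcgrad _ hv2)]
    exact Real.sq_sqrt (intOn_nonneg fun p => by unfold gradSq; positivity)
  have hlapv : vLapn L1 L2 v ^ 2 = intOn L1 L2 (fun p => lap (c1 v) p ^ 2) +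
      intOn L1 L2 (fun p => lap (c2 v) p ^ 2) := by
    have k1 := hclap _ hv1
    have k2 := hclap _ hv2
    rw [← intOn_add (by fun_prop) (by fun_prop)]
    exact Real.sq_sqrt (intOn_nonneg fun p => by positivity)
  have hnV : vL2n L1 L2 V ^ 2 = intOn L1 L2 (fun p => c1 V p ^ 2) +
      intOn L1 L2 (fun p => c2 V p ^ 2) :=
    Real.sq_sqrt (add_nonneg (hsq0 _) (hsq0 _))
  have hpdz : ∀ f : Pt → ℝ, ContDiff ℝ (⊤ : ℕ∞) f →
      intOn L1 L2 (fun p => pdz f p ^ 2) ≤ intOn L1 L2 (gradSq f) := fun f hf =>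
    intOn_mono ((contDiff_pdz hf).continuous.pow 2) (hcgrad f hf) fun p => by
      unfold gradSq
      linarith [sq_nonneg (pdx f p), sq_nonneg (pdy f p)]
  set G := vGradn L1 L2 V with hGdef
  set n := vL2n L1 L2 V
  set D := vGradn L1 L2 v
  set Λ := vLapn L1 L2 v
  have G0 : 0 ≤ G := Real.sqrt_nonneg _
  have n0 : 0 ≤ n := Real.sqrt_nonneg _
  have D0 : 0 ≤ D := Real.sqrt_nonneg _
  have Λ0 : 0 ≤ Λ := Real.sqrt_nonneg _
  have e1 := intOn_mul_abs_mul_pdz_le hL1 hL2 cF hV1 hv1 hvp.1 hV10 (n := n) (D := D) G0 Λ0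
    (L2n_le_of_sq_le n0 (by linarith [hsq0 (c2 V)])) (by linarith [hgrad0 (c2 V)])
    (L2n_le_of_sq_le D0 (by linarith [hpdz _ hv1, hgrad0 (c2 v)])) (by linarith [hsq0 (lap (c2 v))])
  have e2 := intOn_mul_abs_mul_pdz_le hL1 hL2 cF hV2 hv2 hvp.2 hV20 (n := n) (D := D) G0 Λ0
    (L2n_le_of_sq_le n0 (by linarith [hsq0 (c1 V)])) (by linarith [hgrad0 (c1 V)])
    (L2n_le_of_sq_le D0 (by linarith [hpdz _ hv2, hgrad0 (c1 v)])) (by linarith [hsq0 (lap (c1 v))])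
  have hFG : √(∫ x in (0 : ℝ)..L1, ∫ y in (0 : ℝ)..L2, F x y ^ 2) ≤ 2 * G := by
    refine Real.sqrt_le_iff.2 ⟨by positivity, (intervalIntegral_sq_divH_le hL1' hL2' hV1 hV2).trans_eq ?_⟩
    rw [mul_pow, hGdef, vGradn, Real.sq_sqrt]
    · norm_num
    · exact intOn_nonneg fun p => by unfold gradSq; positivity
  have hbound : |∫ p in OmegaSet L1 L2, W p * ((V p).1 * pdz (c1 v) p + (V p).2 * pdz (c2 v) p)| ≤
      intOn L1 L2 (fun p => F p.1 p.2.1 * |c1 V p * pdz (c1 v) p| +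
        F p.1 p.2.1 * |c2 V p * pdz (c2 v) p|) := by
    have hc : Continuous fun p => F p.1 p.2.1 * |c1 V p * pdz (c1 v) p| +
        F p.1 p.2.1 * |c2 V p * pdz (c2 v) p| := by fun_prop
    refine MeasureTheory.norm_integral_le_of_norm_le (G := ℝ) (integrableOn_OmegaSet hc) ?_
    have hm : MeasurableSet (OmegaSet L1 L2) :=
      measurableSet_Ioo.prod (measurableSet_Ioo.prod measurableSet_Ioo)
    filter_upwards [ae_restrict_mem hm] with p hp
    rw [Real.norm_eq_abs, abs_mul, ← mul_add]
    exact mul_le_mul (hWF p hp) (abs_add_le _ _) (abs_nonneg _) ((abs_nonneg _).trans (hWF p hp))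
  rw [intOn_add (by fun_prop) (by fun_prop)] at hbound
  set R := √(n * (((L1 + L2 + 2) / L1 + 2) * G) * (D * ((2 / L2 + 2) * Λ))) with hR
  have hR' : R = √(((L1 + L2 + 2) / L1 + 2) * (2 / L2 + 2)) * √G * √n * √D * √Λ := by
    rw [← Real.sqrt_mul (by positivity), ← Real.sqrt_mul (by positivity),
      ← Real.sqrt_mul (by positivity), ← Real.sqrt_mul (by positivity), hR]
    congr 1
    ring
  have hRF : √(∫ x in (0 : ℝ)..L1, ∫ y in (0 : ℝ)..L2, F x y ^ 2) * R ≤ 2 * G * R :=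
    mul_le_mul_of_nonneg_right hFG (Real.sqrt_nonneg _)
  calc _ ≤ 4 * G * R := by linarith
    _ = _ := by rw [hR']; ring
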